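/- arXiv:0806.0281 — 3 statements merged into one kernel-verified Lean document; each statement's English description precedes it below -/
import Mathlib

section
/- Let k ≥ 1 and k+1 ≤ s ≤ n. Then p^1_{n;≤s;k} = Σ_{i=1}^{s−k−1} C(n−1, s−i−k−1) · p_{n+k−s+i; ≤ i} · p^1_{s−k−i, s−i−1; ≤ s−i−1}, where C(a,b) is the binomial coefficient. -/
/-- One parking step: a car with preference `a` parks in the first unoccupied
space `j` with `a ≤ j ≤ m`, if such a space exists; otherwise it leaves. -/
def parkStep (m : ℕ) (occ : Finset ℕ) (a : ℕ) : Finset ℕ :=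
  if h : ((Finset.Icc a m) \ occ).Nonempty then
    insert (((Finset.Icc a m) \ occ).min' h) occ
  else occ

/-- The set of occupied spaces after the cars with preference list `l`
(in order of arrival) have tried to park among spaces `1, …, m`. -/
def occupied (m : ℕ) (l : List ℕ) : Finset ℕ := l.foldl (parkStep m) ∅

/-- The number of cars that leave unparked. -/
def flaws (m : ℕ) (l : List ℕ) : ℕ := l.length - (occupied m l).card

/-- The preference list (with entries in `[1, s]`) encoded by a function `Fin n → Fin s`. -/
def prefList {n s : ℕ} (f : Fin n → Fin s) : List ℕ :=
  (List.ofFn f).map (fun i => (i : ℕ) + 1)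

/-- `p n m s k` is the number of `k`-flaw preference sets of length `n` with `m`
parking spaces, all of whose entries are at most `s`. -/
def p (n m s k : ℕ) : ℕ :=
  (Finset.univ.filter (fun f : Fin n → Fin s => flaws m (prefList f) = k)).card

/-- `pL n m s k l` is the number of `k`-flaw preference sets of length `n` with `m`
parking spaces, entries at most `s`, and first entry `l`. -/
def pL (n m s k l : ℕ) : ℕ :=
  (Finset.univ.filter (fun f : Fin n → Fin s =>
    flaws m (prefList f) = k ∧ (prefList f).head? = some l)).card

/-- The set of empty spaces. -/
def empties (m : ℕ) (l : List ℕ) : Finset ℕ := Finset.Icc 1 m \ occupied m l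

/-- `n_α`: the number of entries equal to the first entry. -/
def nstat (l : List ℕ) : ℕ := l.count l.headI

/-- `h_α`: the number of empty spaces smaller than the first entry. -/
def hstat (m : ℕ) (l : List ℕ) : ℕ := ((empties m l).filter (fun x => x < l.headI)).card

/-- `τ_α`: the number of entries smaller than the first entry, plus one. -/
def taustat (l : List ℕ) : ℕ := l.countP (fun a => a < l.headI) + 1

/-- `m_α`: the largest empty space. -/
def mstat (m : ℕ) (l : List ℕ) : ℕ := (empties m l).sup id

lemma mem_parkStep (m : ℕ) (occ : Finset ℕ) (a x : ℕ) :
    x ∈ parkStep m occ a ↔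
      x ∈ occ ∨ (a ≤ x ∧ x ≤ m ∧ x ∉ occ ∧ ∀ y, a ≤ y → y < x → y ∈ occ) := by
  unfold parkStep
  split_ifs with h
  · rw [Finset.mem_insert]
    have h1 := Finset.min'_mem _ h
    have h2 : ∀ y ∈ Finset.Icc a m \ occ, Finset.min' _ h ≤ y :=
      fun y hy => Finset.min'_le (Finset.Icc a m \ occ) y hy
    generalize Finset.min' _ h = z at h1 h2
    simp only [Finset.mem_sdiff, Finset.mem_Icc] at h1 h2
    constructor
    · rintro (rfl | hx)
      · right
        refine ⟨h1.1.1, h1.1.2, h1.2, fun y hy hyx => ?_⟩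
        by_contra hc
        have := h2 y ⟨⟨hy, by omega⟩, hc⟩
        omega
      · exact Or.inl hx
    · rintro (hx | ⟨h3, h4, h5, h6⟩)
      · exact Or.inr hx
      · left
        have := h2 x ⟨⟨h3, h4⟩, h5⟩
        by_contra hne
        exact h1.2 (h6 z h1.1.1 (by omega))
  · constructor
    · exact Or.inl
    · rintro (hx | ⟨h3, h4, h5, h6⟩)
      · exact hx
      · exact absurd ⟨x, by simp [h3, h4, h5]⟩ h

lemma card_parkStep (m : ℕ) (occ : Finset ℕ) (a y : ℕ) (h1 : a ≤ y) (h2 : y ≤ m) (h3 : y ∉ occ) :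
    (parkStep m occ a).card = occ.card + 1 := by
  have h : ((Finset.Icc a m) \ occ).Nonempty := ⟨y, by simp [h1, h2, h3]⟩
  unfold parkStep
  rw [dif_pos h, Finset.card_insert_of_notMem]
  have := Finset.min'_mem _ h
  exact (Finset.mem_sdiff.mp this).2

lemma card_parkStep_le (m : ℕ) (occ : Finset ℕ) (a : ℕ) :
    (parkStep m occ a).card ≤ occ.card + 1 := by
  unfold parkStep
  split_ifs with h
  · exact Finset.card_insert_le _ _
  · omega

lemma parkStep_full (m : ℕ) (occ : Finset ℕ) (a : ℕ) (h : ∀ y, a ≤ y → y ≤ m → y ∈ occ) :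
    parkStep m occ a = occ := by
  ext x
  rw [mem_parkStep]
  grind

lemma occupied_nil (m : ℕ) : occupied m [] = ∅ := rfl

lemma occupied_snoc (m : ℕ) (l : List ℕ) (a : ℕ) :
    occupied m (l ++ [a]) = parkStep m (occupied m l) a := by
  simp [occupied]

lemma card_occupied_le (m : ℕ) (l : List ℕ) : (occupied m l).card ≤ l.length := by
  induction l using List.reverseRecOn with
  | nil => simp [occupied_nil]
  | append_singleton l a ih =>
    rw [occupied_snoc]
    have := card_parkStep_le m (occupied m l) a
    simp
    omega

lemma flaws_zero (m : ℕ) (l : List ℕ) : flaws m l = 0 ↔ (occupied m l).card = l.length := by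
  have := card_occupied_le m l
  unfold flaws
  omega

lemma occupied_bound (m b : ℕ) (l : List ℕ) (hl : ∀ a ∈ l, b ≤ a) :
    occupied m l ⊆ Finset.Icc b m := by
  induction l using List.reverseRecOn with
  | nil => simp [occupied_nil]
  | append_singleton l a ih =>
    rw [occupied_snoc]
    intro x hx
    rw [mem_parkStep] at hx
    have ha := hl a (by simp)
    have ih := ih (fun a h => hl a (by simp [h]))
    rcases hx with hx | hx
    · exact ih hx
    · simp; omega

/-- splitting at an empty space -/
lemma split_occ (m t : ℕ) (ht : 1 ≤ t) (htm : t ≤ m) (l : List ℕ)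
    (h : t ∉ occupied m l) :
    t ∉ l ∧ occupied m l = occupied (t-1) (l.filter (fun x => x < t)) ∪
        occupied m (l.filter (fun x => t < x)) ∧
      flaws (t-1) (l.filter (fun x => x < t)) = 0 := by
  induction l using List.reverseRecOn with
  | nil => simp [occupied_nil, flaws]
  | append_singleton l a ih =>
    rw [occupied_snoc] at h ⊢
    have h0 : t ∉ occupied m l := fun hc => h (by rw [mem_parkStep]; exact Or.inl hc)
    obtain ⟨i1, i2, i3⟩ := ih h0
    have hA : occupied (t-1) (l.filter (fun x => x < t)) ⊆ Finset.Icc 0 (t-1) :=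
      occupied_bound _ _ _ (by simp)
    have hB : occupied m (l.filter (fun x => t < x)) ⊆ Finset.Icc (t+1) m :=
      occupied_bound _ _ _ (by simp)
    rw [flaws_zero] at i3 ⊢
    rcases lt_trichotomy a t with hat | hat | hat
    · have e1 : (l ++ [a]).filter (fun x => x < t) = l.filter (fun x => x < t) ++ [a] := by
        simp [List.filter_append, hat]
      have e2 : (l ++ [a]).filter (fun x => t < x) = l.filter (fun x => t < x) := by
        simp [List.filter_append, hat.le]
      rw [e1, e2, occupied_snoc]
      rw [mem_parkStep] at h
      have : ∃ y, a ≤ y ∧ y < t ∧ y ∉ occupied m l := by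
        by_contra hc
        push Not at hc
        exact h (Or.inr ⟨hat.le, htm, h0, hc⟩)
      obtain ⟨y, y1, y2, y3⟩ := this
      generalize occupied (t-1) (l.filter (fun x => x < t)) = A at *
      generalize occupied m (l.filter (fun x => t < x)) = B at *
      refine ⟨by simp [i1]; omega, ?_, ?_⟩
      · rw [i2] at y3 ⊢
        simp only [Finset.subset_iff, Finset.mem_Icc] at hA hB
        ext x
        simp only [mem_parkStep, Finset.mem_union] at *
        constructor
        · rintro (hx | ⟨x1, x2, x3, x4⟩)
          · tauto
          · have : x ≤ y := by
              by_contra hc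
              exact y3 (x4 y y1 (by omega))
            left; right
            refine ⟨x1, by omega, by tauto, fun z z1 z2 => ?_⟩
            rcases x4 z z1 z2 with hz | hz
            · exact hz
            · have := hB hz; omega
        · rintro ((hx | ⟨x1, x2, x3, x4⟩) | hx)
          · tauto
          · right
            refine ⟨x1, by omega, ?_, fun z z1 z2 => Or.inl (x4 z z1 z2)⟩
            rintro (hx | hx)
            · exact x3 hx
            · have := hB hx; omega
          · tauto
      · rw [card_parkStep _ _ _ y y1 (by omega) (by rw [i2] at y3; simp at y3; tauto), i3]
        simp
    · subst hat
      exfalso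
      rw [mem_parkStep] at h
      exact h (Or.inr ⟨le_rfl, htm, h0, by omega⟩)
    · have e1 : (l ++ [a]).filter (fun x => x < t) = l.filter (fun x => x < t) := by
        simp [List.filter_append, hat.le]
      have e2 : (l ++ [a]).filter (fun x => t < x) = l.filter (fun x => t < x) ++ [a] := by
        simp [List.filter_append, hat]
      rw [e1, e2, occupied_snoc]
      generalize occupied (t-1) (l.filter (fun x => x < t)) = A at *
      generalize occupied m (l.filter (fun x => t < x)) = B at *
      refine ⟨by simp [i1]; omega, ?_, i3⟩
      rw [i2]
      simp only [Finset.subset_iff, Finset.mem_Icc] at hA hB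
      ext x
      simp only [mem_parkStep, Finset.mem_union] at *
      constructor
      · rintro (hx | ⟨x1, x2, x3, x4⟩)
        · tauto
        · right; right
          refine ⟨x1, by omega, by tauto, fun z z1 z2 => ?_⟩
          rcases x4 z z1 z2 with hz | hz
          · have := hA hz; omega
          · exact hz
      · rintro (hx | hx | ⟨x1, x2, x3, x4⟩)
        · tauto
        · tauto
        · right
          refine ⟨x1, by omega, ?_, fun z z1 z2 => Or.inr (x4 z z1 z2)⟩
          rintro (hx | hx)
          · have := hA hx; omega
          · exact x3 hx

lemma split_conv (m t : ℕ) (ht : 1 ≤ t) (htm : t ≤ m) (l : List ℕ) (h : t ∉ l)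
    (hf : flaws (t-1) (l.filter (fun x => x < t)) = 0) : t ∉ occupied m l := by
  induction l using List.reverseRecOn with
  | nil => simp [occupied_nil]
  | append_singleton l a ih =>
    simp only [List.mem_append, List.mem_singleton, not_or] at h
    rw [flaws_zero] at hf ih
    rw [occupied_snoc, mem_parkStep]
    rcases lt_or_gt_of_ne h.2 with hat | hat
    · have e2 : (l ++ [a]).filter (fun x => x < t) = l.filter (fun x => x < t) := by
        simp [List.filter_append, hat.le]
      rw [e2] at hf
      have ih := ih h.1 hf
      rintro (hc | hc)
      · exact ih hc
      · omega
    · have hat : a < t := hat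
      have e1 : (l ++ [a]).filter (fun x => x < t) = l.filter (fun x => x < t) ++ [a] := by
        simp [List.filter_append, hat]
      rw [e1, occupied_snoc] at hf
      have h1 := card_parkStep_le (t-1) (occupied (t-1) (l.filter (fun x => x < t))) a
      have h2 := card_occupied_le (t-1) (l.filter (fun x => x < t))
      have hf' := hf
      rw [List.length_append, List.length_singleton] at hf
      have hf2 : (occupied (t-1) (l.filter (fun x => x < t))).card =
        (l.filter (fun x => x < t)).length := by omega
      have ih := ih h.1 hf2
      obtain ⟨-, i2, -⟩ := split_occ m t ht htm l ih
      rintro (hc | ⟨-, -, -, hc⟩)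
      · exact ih hc
      · have := parkStep_full (t-1) (occupied (t-1) (l.filter (fun x => x < t))) a (by
          intro y y1 y2
          have := hc y y1 (by omega)
          rw [i2, Finset.mem_union] at this
          rcases this with h | h
          · exact h
          · have := occupied_bound m (t+1) (l.filter (fun x => t < x)) (by simp) h
            simp at this
            omega)
        rw [this] at hf
        omega

lemma occ_shift (m t : ℕ) (l : List ℕ) (x : ℕ) :
    x ∈ occupied (m + t) (l.map (· + t)) ↔ ∃ y ∈ occupied m l, x = y + t := by
  induction l using List.reverseRecOn generalizing x with
  | nil => simp [occupied_nil]
  | append_singleton l a ih =>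
    rw [List.map_append, List.map_singleton, occupied_snoc, occupied_snoc]
    simp only [mem_parkStep, ih]
    constructor
    · rintro (⟨y, h, rfl⟩ | ⟨h1, h2, h3, h4⟩)
      · exact ⟨y, Or.inl h, rfl⟩
      · refine ⟨x - t, Or.inr ⟨by omega, by omega, fun hc => h3 ⟨_, hc, by omega⟩, ?_⟩, by omega⟩
        intro y y1 y2
        obtain ⟨z, z1, z2⟩ := h4 (y + t) (by omega) (by omega)
        have : y = z := by omega
        exact this ▸ z1
    · rintro ⟨y, (h | ⟨h1, h2, h3, h4⟩), rfl⟩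
      · exact Or.inl ⟨y, h, rfl⟩
      · right
        refine ⟨by omega, by omega, ?_, ?_⟩
        · rintro ⟨z, z1, z2⟩
          have : y = z := by omega
          exact h3 (this ▸ z1)
        · intro z z1 z2
          exact ⟨z - t, h4 _ (by omega) (by omega), by omega⟩

lemma occ_trunc (m k : ℕ) (l : List ℕ) (x : ℕ) :
    x ∈ occupied m l ↔ x ∈ occupied (m + k) l ∧ x ≤ m := by
  induction l using List.reverseRecOn generalizing x with
  | nil => simp [occupied_nil]
  | append_singleton l a ih =>
    rw [occupied_snoc, occupied_snoc]
    simp only [mem_parkStep, ih]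
    constructor
    · rintro (h | ⟨h1, h2, h3, h4⟩)
      · exact ⟨Or.inl h.1, h.2⟩
      · exact ⟨Or.inr ⟨h1, by omega, by tauto, fun y y1 y2 => (h4 y y1 y2).1⟩, h2⟩
    · rintro ⟨h | ⟨h1, h2, h3, h4⟩, h5⟩
      · exact Or.inl ⟨h, h5⟩
      · exact Or.inr ⟨h1, h5, by tauto, fun y y1 y2 => ⟨h4 y y1 y2, by omega⟩⟩

lemma full_iff (N k : ℕ) (l : List ℕ) (h1 : ∀ a ∈ l, 1 ≤ a ∧ a ≤ N) (hl : l.length = N + k) :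
    (∀ x, 1 ≤ x → x ≤ N → x ∈ occupied N l) ↔ flaws (N + k) l = 0 := by
  have hsub := occupied_bound (N+k) 1 l (fun a ha => (h1 a ha).1)
  rw [flaws_zero, hl]
  constructor
  · intro h
    suffices hs : Finset.Icc 1 (N+k) ⊆ occupied (N+k) l by
      rw [Finset.Subset.antisymm hsub hs]; simp
    intro e he
    by_contra hc
    rw [Finset.mem_Icc] at he
    have heN : N < e := by
      by_contra h'
      exact hc ((occ_trunc N k l e).1 (h e he.1 (by omega))).1
    obtain ⟨-, -, i3⟩ := split_occ (N+k) e he.1 he.2 l hc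
    have : l.filter (fun x => x < e) = l := by
      rw [List.filter_eq_self]
      intro a ha
      have := h1 a ha
      simp; omega
    rw [this, flaws_zero] at i3
    have hb := Finset.card_le_card (occupied_bound (e-1) 1 l (fun a ha => (h1 a ha).1))
    simp at hb
    omega
  · intro h x x1 x2
    have := Finset.eq_of_subset_of_card_le hsub (by simp [h])
    rw [occ_trunc N k, this]
    simp; omega

lemma upper_iff (n t s k : ℕ) (htn : t ≤ n) (hs : s ≤ n) (r : List ℕ)
    (h1 : ∀ a ∈ r, t < a ∧ a ≤ s) (hl : r.length = n - t + k) :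
    (∀ x, t < x → x ≤ n → x ∈ occupied n r) ↔ flaws (n - t + k) (r.map (· - t)) = 0 := by
  obtain ⟨N, rfl⟩ := Nat.exists_eq_add_of_le' htn
  have hr : (r.map (· - t)).map (· + t) = r := by
    rw [List.map_map]
    conv_rhs => rw [← List.map_id r]
    apply List.map_congr_left
    intro a ha
    have := h1 a ha
    simp; omega
  simp only [Nat.add_sub_cancel] at hl ⊢
  rw [← full_iff N k]
  · conv_lhs => rw [← hr]
    simp only [occ_shift]
    constructor
    · intro h x x1 x2
      obtain ⟨y, y1, y2⟩ := h (x + t) (by omega) (by omega)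
      have : x = y := by omega
      exact this ▸ y1
    · intro h x x1 x2
      exact ⟨x - t, h _ (by omega) (by omega), by omega⟩
  · intro a ha
    rw [List.mem_map] at ha
    obtain ⟨b, hb, rfl⟩ := ha
    have := h1 b hb
    omega
  · simpa using hl

/-- The condition attached to last empty space `t`. -/
def Qc (n k t : ℕ) (L : List ℕ) : Prop :=
  (L.filter (fun x => x < t)).length = t - k ∧ (L.filter (fun x => t < x)).length = n - t + k ∧
  flaws (t-1) (L.filter (fun x => x < t)) = 0 ∧
  flaws (n-t+k) ((L.filter (fun x => t < x)).map (· - t)) = 0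

lemma filter_len (t : ℕ) (L : List ℕ) : (L.filter (fun x => x < t)).length +
    (L.filter (fun x => t < x)).length + L.count t = L.length := by
  induction L with
  | nil => simp
  | cons a L ih =>
    rcases lt_trichotomy a t with h | h | h
    · have : a ≠ t := by omega
      simp [List.filter_cons, List.count_cons, h, h.le, this, not_lt.2 h.le]; omega
    · subst h
      simp [List.filter_cons, List.count_cons]; omega
    · have : a ≠ t := by omega
      simp [List.filter_cons, List.count_cons, h, h.le, this, not_lt.2 h.le]; omega

lemma Qc_iff (n s k t : ℕ) (hk : 1 ≤ k) (hsn : s ≤ n) (ht1 : k ≤ t) (ht2 : t ≤ n)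
    (L : List ℕ) (hL : L.length = n) (hb : ∀ a ∈ L, 1 ≤ a ∧ a ≤ s) :
    Qc n k t L ↔ flaws n L = k ∧ t ∉ occupied n L ∧
      ∀ x, t < x → x ≤ n → x ∈ occupied n L := by
  have hlen := filter_len t L
  have key : t ∉ occupied n L → (t ∉ L ∧ occupied n L = occupied (t-1) (L.filter (fun x => x < t)) ∪
        occupied n (L.filter (fun x => t < x)) ∧
      flaws (t-1) (L.filter (fun x => x < t)) = 0) := split_occ n t (by omega) ht2 L
  have hA : occupied (t-1) (L.filter (fun x => x < t)) ⊆ Finset.Icc 0 (t-1) :=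
      occupied_bound _ _ _ (by simp)
  have hB : occupied n (L.filter (fun x => t < x)) ⊆ Finset.Icc (t+1) n :=
      occupied_bound _ _ _ (by simp)
  have hdis : Disjoint (occupied (t-1) (L.filter (fun x => x < t)))
      (occupied n (L.filter (fun x => t < x))) := by
    rw [Finset.disjoint_left]
    intro x hx hy
    have := hA hx
    have := hB hy
    simp at *
    omega
  have hup := upper_iff n t s k ht2 hsn (L.filter (fun x => t < x)) (by
    intro a ha
    simp at ha
    exact ⟨ha.2, (hb a ha.1).2⟩)
  have hcl := card_occupied_le n L
  unfold Qc
  constructor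
  · rintro ⟨q1, q2, q3, q4⟩
    have htL : t ∉ L := by
      rw [← List.count_eq_zero]; omega
    have hocc := split_conv n t (by omega) ht2 L htL q3
    obtain ⟨-, k2, k3⟩ := key hocc
    have hfull := (hup q2).2 q4
    have hBe : occupied n (L.filter (fun x => t < x)) = Finset.Icc (t+1) n := by
      apply Finset.Subset.antisymm hB
      intro x hx
      rw [Finset.mem_Icc] at hx
      exact hfull x (by omega) (by omega)
    refine ⟨?_, hocc, ?_⟩
    · unfold flaws
      rw [flaws_zero] at k3
      rw [k2, Finset.card_union_of_disjoint hdis, hBe, k3]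
      simp
      omega
    · intro x x1 x2
      rw [k2, Finset.mem_union]
      exact Or.inr (hfull x x1 x2)
  · rintro ⟨r1, r2, r3⟩
    obtain ⟨k1, k2, k3⟩ := key r2
    have hfull : ∀ x, t < x → x ≤ n → x ∈ occupied n (L.filter (fun x => t < x)) := by
      intro x x1 x2
      have := r3 x x1 x2
      rw [k2, Finset.mem_union] at this
      rcases this with h | h
      · have := hA h
        simp at this
        omega
      · exact h
    have hBe : occupied n (L.filter (fun x => t < x)) = Finset.Icc (t+1) n := by
      apply Finset.Subset.antisymm hB
      intro x hx
      rw [Finset.mem_Icc] at hx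
      exact hfull x (by omega) (by omega)
    have k3' := k3
    rw [flaws_zero] at k3'
    have hc : (occupied n L).card = (L.filter (fun x => x < t)).length + (n - t) := by
      rw [k2, Finset.card_union_of_disjoint hdis, hBe, k3']
      simp
    unfold flaws at r1
    rw [← List.count_eq_zero] at k1
    have q2 : (L.filter (fun x => t < x)).length = n - t + k := by omega
    exact ⟨by omega, q2, k3, (hup q2).1 hfull⟩

open Classical in
lemma indicator_eq (n s k : ℕ) (hk : 1 ≤ k) (hsn : s ≤ n)
    (l : List ℕ) (hL : l.length + 1 = n) (hb : ∀ a ∈ l, 1 ≤ a ∧ a ≤ s) (hs1 : 1 ≤ s) :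
    (if flaws n (1 :: l) = k then 1 else 0) =
      ∑ t ∈ Finset.Icc (k+1) (s-1), if Qc n k t (1 :: l) then 1 else 0 := by
  have hb' : ∀ a ∈ 1 :: l, 1 ≤ a ∧ a ≤ s := by
    intro a ha
    rcases List.mem_cons.1 ha with rfl | ha
    · omega
    · exact hb a ha
  have hiff := fun t h1 h2 => Qc_iff n s k t hk hsn h1 h2 (1 :: l) (by simpa using hL) hb'
  split_ifs with hf
  · have hsub := occupied_bound n 1 (1::l) (fun a ha => (hb' a ha).1)
    have hne : (Finset.Icc 1 n \ occupied n (1::l)).Nonempty := by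
      rw [Finset.nonempty_iff_ne_empty]
      intro hc
      rw [Finset.sdiff_eq_empty_iff_subset] at hc
      have := Finset.card_le_card hc
      unfold flaws at hf
      simp at this hf
      omega
    have hm := Finset.max'_mem _ hne
    have hmax : ∀ y ∈ Finset.Icc 1 n \ occupied n (1::l), y ≤ Finset.max' _ hne :=
      fun y hy => Finset.le_max' (Finset.Icc 1 n \ occupied n (1::l)) y hy
    generalize Finset.max' _ hne = t at hm hmax
    rw [Finset.mem_sdiff, Finset.mem_Icc] at hm
    have hr3 : ∀ x, t < x → x ≤ n → x ∈ occupied n (1::l) := by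
      intro x x1 x2
      by_contra hc
      have := hmax x (by simp [hc]; omega)
      omega
    have hkt : k ≤ t := by
      have h1 : Finset.Icc (t+1) n ⊆ occupied n (1::l) := by
        intro x hx
        rw [Finset.mem_Icc] at hx
        exact hr3 x (by omega) hx.2
      have := Finset.card_le_card h1
      unfold flaws at hf
      simp at this hf
      omega
    have hQ := (hiff t hkt hm.1.2).2 ⟨hf, hm.2, hr3⟩
    have hlen := filter_len t (1::l)
    obtain ⟨k1, -, -⟩ := split_occ n t (by omega) hm.1.2 (1::l) hm.2
    have ht1 : 1 < t := by
      have : t ≠ 1 := by rintro rfl; simp at k1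
      omega
    have htk : k + 1 ≤ t := by
      have := hQ.1
      rw [List.filter_cons] at this
      simp [ht1] at this
      omega
    have hts : t < s := by
      by_contra hc
      have h2 := hQ.2.1
      have : (1::l).filter (fun x => t < x) = [] := by
        rw [List.filter_eq_nil_iff]
        intro a ha
        have := hb' a ha
        simp; omega
      rw [this] at h2
      simp at h2
      omega
    rw [Finset.sum_eq_single t]
    · rw [if_pos hQ]
    · intro u hu hut
      rw [if_neg]
      rw [Finset.mem_Icc] at hu
      rw [hiff u (by omega) (by omega)]
      rintro ⟨-, u2, u3⟩
      rcases lt_or_gt_of_ne hut with h | h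
      · exact hm.2 (u3 t h hm.1.2)
      · exact u2 (hr3 u h (by omega))
    · intro h
      exact absurd (Finset.mem_Icc.2 ⟨htk, by omega⟩) h
  · symm
    apply Finset.sum_eq_zero
    intro t ht
    rw [Finset.mem_Icc] at ht
    rw [if_neg]
    rw [hiff t (by omega) (by omega)]
    exact fun h => hf h.1

/-- Sum of a weight over all words of length `n` over `U`. -/
def cnt : ℕ → Finset ℕ → (List ℕ → ℕ) → ℕ
  | 0, _, w => w []
  | n+1, U, w => ∑ x ∈ U, cnt n U (fun l => w (x :: l))

lemma cnt_congr (n : ℕ) (U : Finset ℕ) (w v : List ℕ → ℕ)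
    (h : ∀ l, l.length = n → (∀ a ∈ l, a ∈ U) → w l = v l) : cnt n U w = cnt n U v := by
  induction n generalizing w v with
  | zero => exact h [] rfl (by simp)
  | succ n ih =>
    apply Finset.sum_congr rfl
    intro x hx
    apply ih
    intro l hl ha
    exact h _ (by simp [hl]) (by simpa [hx] using ha)

lemma cnt_zero (n : ℕ) (U : Finset ℕ) : cnt n U (fun _ => 0) = 0 := by
  induction n with
  | zero => rfl
  | succ n ih => simp [cnt, ih]

lemma cnt_sum {ι : Type} (I : Finset ι) (n : ℕ) (U : Finset ℕ) (w : ι → List ℕ → ℕ) :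
    cnt n U (fun l => ∑ i ∈ I, w i l) = ∑ i ∈ I, cnt n U (w i) := by
  induction n generalizing w with
  | zero => rfl
  | succ n ih =>
    simp only [cnt]
    rw [Finset.sum_comm]
    exact Finset.sum_congr rfl fun x _ => ih _

lemma cnt_shift (n t i : ℕ) (w : List ℕ → ℕ) :
    cnt n (Finset.Icc (t+1) (t+i)) (fun l => w (l.map (· - t))) = cnt n (Finset.Icc 1 i) w := by
  induction n generalizing w with
  | zero => rfl
  | succ n ih =>
    simp only [cnt, List.map_cons]
    have : Finset.Icc (t+1) (t+i) = (Finset.Icc 1 i).map (addLeftEmbedding t) := by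
      rw [Finset.map_add_left_Icc]
    conv_lhs => rw [this, Finset.sum_map, ← this]
    apply Finset.sum_congr rfl
    intro x _
    simp only [addLeftEmbedding_apply, Nat.add_sub_cancel_left]
    exact ih (fun l => w (x :: l))

/-- Shuffle weight. -/
def shw (t a b : ℕ) (A B : List ℕ → ℕ) (l : List ℕ) : ℕ :=
  if (l.filter (fun x => x < t)).length = a ∧ (l.filter (fun x => t < x)).length = b then
    A (l.filter (fun x => x < t)) * B (l.filter (fun x => t < x)) else 0

lemma cnt_shuffle (t s : ℕ) (ht : 1 ≤ t) (hts : t ≤ s) (n a b : ℕ) (hab : a + b = n)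
    (A B : List ℕ → ℕ) :
    cnt n (Finset.Icc 1 s) (shw t a b A B) =
      Nat.choose n a * cnt a (Finset.Icc 1 (t-1)) A * cnt b (Finset.Icc (t+1) s) B := by
  induction n generalizing a b A B with
  | zero =>
    obtain rfl : a = 0 := by omega
    obtain rfl : b = 0 := by omega
    simp [cnt, shw]
  | succ n ih =>
    have hU : Finset.Icc 1 s = Finset.Icc 1 (t-1) ∪ ({t} ∪ Finset.Icc (t+1) s) := by
      ext x; simp; omega
    have hd1 : Disjoint (Finset.Icc 1 (t-1)) ({t} ∪ Finset.Icc (t+1) s) := by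
      rw [Finset.disjoint_left]; intro x; simp; omega
    have hd2 : Disjoint ({t} : Finset ℕ) (Finset.Icc (t+1) s) := by
      rw [Finset.disjoint_left]; intro x; simp; omega
    have hrec : ∀ w, cnt (n+1) (Finset.Icc 1 s) w =
        ∑ x ∈ Finset.Icc 1 s, cnt n (Finset.Icc 1 s) (fun l => w (x :: l)) := fun w => rfl
    have hsplit : ∀ F : ℕ → ℕ, ∑ x ∈ Finset.Icc 1 s, F x =
        ∑ x ∈ Finset.Icc 1 (t-1), F x + (F t + ∑ x ∈ Finset.Icc (t+1) s, F x) := by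
      intro F
      rw [hU, Finset.sum_union hd1, Finset.sum_union hd2, Finset.sum_singleton]
    rw [hrec, hsplit]
    have hmid : cnt n (Finset.Icc 1 s) (fun l => shw t a b A B (t :: l)) = 0 := by
      rw [← cnt_zero n (Finset.Icc 1 s)]
      apply cnt_congr
      intro l hl _
      have := filter_len t l
      unfold shw
      rw [if_neg]
      simp [List.filter_cons]
      omega
    have hlow : ∑ x ∈ Finset.Icc 1 (t-1), cnt n (Finset.Icc 1 s) (fun l => shw t a b A B (x :: l))
        = (if a = 0 then 0 else Nat.choose n (a-1)) * cnt a (Finset.Icc 1 (t-1)) A *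
          cnt b (Finset.Icc (t+1) s) B := by
      rcases a with _ | a
      · simp only [if_true, zero_mul]
        apply Finset.sum_eq_zero
        intro x hx
        rw [Finset.mem_Icc] at hx
        have h1 : x < t := by omega
        conv_rhs => rw [← cnt_zero n (Finset.Icc 1 s)]
        apply cnt_congr
        intro l _ _
        simp [shw, List.filter_cons, h1]
      · simp only [Nat.add_eq_zero_iff, one_ne_zero, and_false, if_false, Nat.add_sub_cancel]
        simp only [cnt]
        rw [Finset.mul_sum, Finset.sum_mul]
        apply Finset.sum_congr rfl
        intro x hx
        rw [Finset.mem_Icc] at hx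
        have h1 : x < t := by omega
        rw [← ih a b (by omega)]
        congr 1
        funext l
        simp [shw, List.filter_cons, h1, not_lt.2 h1.le]
    have hup : ∑ x ∈ Finset.Icc (t+1) s, cnt n (Finset.Icc 1 s) (fun l => shw t a b A B (x :: l))
        = (if b = 0 then 0 else Nat.choose n a) * cnt a (Finset.Icc 1 (t-1)) A *
          cnt b (Finset.Icc (t+1) s) B := by
      rcases b with _ | b
      · simp only [if_true, zero_mul]
        apply Finset.sum_eq_zero
        intro x hx
        rw [Finset.mem_Icc] at hx
        have h1 : t < x := by omega
        conv_rhs => rw [← cnt_zero n (Finset.Icc 1 s)]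
        apply cnt_congr
        intro l _ _
        simp [shw, List.filter_cons, h1]
      · simp only [Nat.add_eq_zero_iff, one_ne_zero, and_false, if_false]
        simp only [cnt]
        rw [Finset.mul_sum]
        apply Finset.sum_congr rfl
        intro x hx
        rw [Finset.mem_Icc] at hx
        have h1 : t < x := by omega
        rw [← ih a b (by omega)]
        congr 1
        funext l
        simp [shw, List.filter_cons, h1, not_lt.2 h1.le]
    rw [hmid, hlow, hup, zero_add, ← add_mul, ← add_mul]
    congr 2
    rcases a with _ | a
    · have : b ≠ 0 := by omega
      simp [this]
    · rcases b with _ | b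
      · obtain rfl : a = n := by omega
        simp
      · simp [Nat.choose_succ_succ]

lemma card_eq_cnt (n s : ℕ) (P : List ℕ → Prop) [DecidablePred P] :
    (Finset.univ.filter (fun f : Fin n → Fin s => P (prefList f))).card =
      cnt n (Finset.Icc 1 s) (fun l => if P l then 1 else 0) := by
  rw [Finset.card_filter]
  induction n generalizing P with
  | zero => simp [cnt, prefList]
  | succ n ih =>
    rw [← (Fin.consEquiv (fun _ : Fin (n+1) => Fin s)).sum_comp, Fintype.sum_prod_type]
    have : Finset.Icc 1 s = Finset.univ.image (fun i : Fin s => (i : ℕ) + 1) := by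
      ext x
      simp only [Finset.mem_Icc, Finset.mem_image, Finset.mem_univ, true_and]
      constructor
      · intro h
        exact ⟨⟨x - 1, by omega⟩, by simp; omega⟩
      · rintro ⟨i, rfl⟩
        omega
    have hrec : ∀ w, cnt (n+1) (Finset.Icc 1 s) w =
        ∑ x ∈ Finset.Icc 1 s, cnt n (Finset.Icc 1 s) (fun l => w (x :: l)) := fun w => rfl
    rw [hrec]
    conv_rhs => rw [this, Finset.sum_image (by intro a _ b _ h; simp at h; omega), ← this]
    apply Finset.sum_congr rfl
    intro x _
    rw [← ih (fun l => P (((x:ℕ) + 1) :: l))]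
    apply Finset.sum_congr rfl
    intro g _
    have hp : prefList ((Fin.consEquiv (fun _ : Fin (n+1) => Fin s)) (x, g)) =
        ((x:ℕ) + 1) :: prefList g := by
      unfold prefList
      rw [List.ofFn_succ]
      rfl
    rw [hp]

lemma p_eq (n m s k : ℕ) :
    p n m s k = cnt n (Finset.Icc 1 s) (fun l => if flaws m l = k then 1 else 0) :=
  card_eq_cnt n s (fun l => flaws m l = k)

lemma pL_eq (n m s k : ℕ) (hs : 1 ≤ s) :
    pL (n+1) m s k 1 =
      cnt n (Finset.Icc 1 s) (fun l => if flaws m (1 :: l) = k then 1 else 0) := by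
  have := card_eq_cnt (n+1) s (fun l => flaws m l = k ∧ l.head? = some 1)
  unfold pL
  rw [this]
  simp only [cnt, List.head?_cons, Option.some.injEq]
  rw [Finset.sum_eq_single 1]
  · simp
  · intro b _ hb
    simp [hb, cnt_zero]
  · intro h
    simp at h
    omega

/-- Theorem 6.2: for `k ≥ 1` and `k+1 ≤ s ≤ n`,
`p^1_{n;≤s;k} = Σ_{i=1}^{s-k-1} C(n-1, s-i-k-1) · p_{n+k-s+i;≤i} · p^1_{s-k-i,s-i-1;≤s-i-1}`. -/
theorem stmt9 (n s k : ℕ) (hk : 1 ≤ k) (hs1 : k + 1 ≤ s) (hsn : s ≤ n) :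
    pL n n s k 1 =
      ∑ i ∈ Finset.Icc 1 (s - k - 1),
        Nat.choose (n - 1) (s - i - k - 1) * p (n + k - s + i) (n + k - s + i) i 0 *
          pL (s - k - i) (s - i - 1) (s - i - 1) 0 1 := by
  classical
  have h1 : pL n n s k 1 = cnt (n-1) (Finset.Icc 1 s)
      (fun l => if flaws n (1 :: l) = k then 1 else 0) := by
    have := pL_eq (n-1) n s k (by omega)
    rwa [Nat.sub_add_cancel (by omega)] at this
  have h2 : cnt (n-1) (Finset.Icc 1 s) (fun l => if flaws n (1 :: l) = k then 1 else 0) =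
      cnt (n-1) (Finset.Icc 1 s)
        (fun l => ∑ t ∈ Finset.Icc (k+1) (s-1), if Qc n k t (1 :: l) then 1 else 0) := by
    apply cnt_congr
    intro l hl ha
    exact indicator_eq n s k hk hsn l (by omega) (by simpa using ha) (by omega)
  rw [h1, h2, cnt_sum]
  refine Finset.sum_bij' (fun t _ => s - t) (fun i _ => s - i) ?_ ?_ ?_ ?_ ?_
  · intro t ht; simp at *; omega
  · intro t ht; simp at *; omega
  · intro t ht; simp at *; omega
  · intro t ht; simp at *; omega
  intro t ht
  rw [Finset.mem_Icc] at ht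
  obtain ⟨i, rfl⟩ : ∃ i, s = t + i := ⟨s - t, by omega⟩
  have e1 : t + i - t = i := by omega
  have e2 : t + i - i = t := by omega
  have e3 : n + k - (t + i) + i = n - t + k := by omega
  have e4 : t + i - k - i = (t - k - 1) + 1 := by omega
  simp only [e1]
  rw [e2, e3, e4, pL_eq _ _ _ _ (by omega), p_eq]
  have h3 := cnt_shuffle t (t+i) (by omega) (by omega) (n-1) (t-k-1) (n-t+k) (by omega)
    (fun l => if flaws (t-1) (1 :: l) = 0 then 1 else 0)
    (fun l => if flaws (n-t+k) (l.map (· - t)) = 0 then 1 else 0)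
  have h4 := cnt_shift (n-t+k) t i (fun l => if flaws (n-t+k) l = 0 then 1 else 0)
  rw [h4] at h3
  rw [mul_right_comm, ← h3]
  congr 1
  funext l
  have ht1 : 1 < t := by omega
  have hh : t - k = (t - k - 1) + 1 := by omega
  have f1 : (1 :: l).filter (fun x => x < t) = 1 :: l.filter (fun x => x < t) := by
    simp [List.filter_cons, ht1]
  have f2 : (1 :: l).filter (fun x => t < x) = l.filter (fun x => t < x) := by
    simp [List.filter_cons]; omega
  unfold Qc shw
  rw [f1, f2, List.length_cons]
  beta_reduce
  have hcc : (l.filter (fun x => x < t)).length + 1 = t - k ↔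
    (l.filter (fun x => x < t)).length = t - k - 1 := by omega
  rw [hcc]
  generalize flaws (t-1) (1 :: l.filter (fun x => x < t)) = X
  generalize flaws (n-t+k) ((l.filter (fun x => t < x)).map (· - t)) = Y
  by_cases c1 : (l.filter (fun x => x < t)).length = t - k - 1 <;>
  by_cases c2 : (l.filter (fun x => t < x)).length = n - t + k <;>
  by_cases c3 : X = 0 <;> by_cases c4 : Y = 0 <;> simp only [c1, c2, c3, c4] <;> simp
end

section
/- For all integers k ≥ 1 and k+2 ≤ s ≤ n, the number of (k+1)-flaw preference sets of length n (with n spaces), entries at most s and first entry s equals the number of k-flaw preference sets of length n (with n spaces), entries at most s and first entry 1: p^s_{n;≤s;k+1} = p^1_{n;≤s;k}. -/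
/-- The two invariants of the parking process. -/
theorem park_inv (m : ℕ) (l : List ℕ) (hl : ∀ a ∈ l, 1 ≤ a) :
    occupied m l ⊆ Finset.Icc 1 m ∧
    (∀ i, ((occupied m l).filter (· ≤ i)).card ≤ l.countP (· ≤ i)) ∧
    (∀ e, e ∉ occupied m l → e ≤ m →
      ((occupied m l).filter (· ≤ e)).card = l.countP (· ≤ e)) := by
  induction l using List.reverseRecOn with
  | nil => simp [occupied]
  | append_singleton l a ih =>
    obtain ⟨h1, h2, h3⟩ := ih (fun x hx => hl x (by simp [hx]))
    have ha : 1 ≤ a := hl a (by simp)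
    have hocc : occupied m (l ++ [a]) = parkStep m (occupied m l) a := by
      simp [occupied]
    rw [hocc]
    generalize occupied m l = occ at *
    unfold parkStep
    split_ifs with h
    · have hj := Finset.min'_mem _ h
      have hmin : ∀ x, a ≤ x → x ≤ m → x ∉ occ → (Finset.Icc a m \ occ).min' h ≤ x := by
        intro x hx1 hx2 hx3
        exact Finset.min'_le _ _ (by simp [hx1, hx2, hx3])
      generalize (Finset.Icc a m \ occ).min' h = j at *
      simp only [Finset.mem_sdiff, Finset.mem_Icc] at hj
      obtain ⟨⟨haj, hjm⟩, hjo⟩ := hj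
      refine ⟨?_, ?_, ?_⟩
      · intro x hx
        rcases Finset.mem_insert.1 hx with rfl | hx
        · simp; omega
        · exact h1 hx
      · intro i
        have := h2 i
        rw [Finset.filter_insert, List.countP_append, List.countP_singleton]
        by_cases hji : j ≤ i
        · have : a ≤ i := by omega
          rw [if_pos hji, Finset.card_insert_of_notMem (by simp [hjo])]
          simp [this]; omega
        · rw [if_neg hji]; omega
      · intro e he hem
        rw [Finset.mem_insert, not_or] at he
        have := h3 e he.2 hem
        rw [Finset.filter_insert, List.countP_append, List.countP_singleton]
        by_cases hji : j ≤ e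
        · have : a ≤ e := by omega
          rw [if_pos hji, Finset.card_insert_of_notMem (by simp [hjo])]
          simp [this]; omega
        · have : ¬ a ≤ e := fun hae => hji (hmin e hae hem he.2)
          rw [if_neg hji]; simp [this]; omega
    · refine ⟨h1, ?_, ?_⟩
      · intro i
        have := h2 i
        rw [List.countP_append]; omega
      · intro e he hem
        have := h3 e he hem
        have hae : ¬ a ≤ e := fun hae => h ⟨e, by simp [hae, hem, he]⟩
        rw [List.countP_append, List.countP_singleton]
        simp [hae]; omega

theorem le_flaws_iff (n : ℕ) (l : List ℕ) (hn : l.length = n) (hl : ∀ a ∈ l, 1 ≤ a) (t : ℕ) :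
    t ≤ flaws n l ↔ ∃ i ≤ n, l.countP (· ≤ i) + t ≤ i := by
  obtain ⟨h1, h2, h3⟩ := park_inv n l hl
  unfold flaws
  rw [hn]
  generalize occupied n l = occ at *
  have hsplit : ∀ i, (occ.filter (· ≤ i)).card + (occ.filter (fun x => ¬ x ≤ i)).card = occ.card :=
    fun i => Finset.card_filter_add_card_filter_not (s := occ) (fun x => x ≤ i)
  have hsub : ∀ i, occ.filter (fun x => ¬ x ≤ i) ⊆ Finset.Ioc i n := by
    intro i x hx
    rw [Finset.mem_filter] at hx
    have := Finset.mem_Icc.1 (h1 hx.1)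
    simp; omega
  constructor
  · intro ht
    have h0 : 0 ∉ occ := fun h => by simpa using h1 h
    have hne : ((Finset.range (n + 1)) \ occ).Nonempty := ⟨0, by simp [h0]⟩
    obtain ⟨i, hi, hmax⟩ : ∃ i ∈ (Finset.range (n + 1)) \ occ,
        ∀ x ∈ (Finset.range (n + 1)) \ occ, x ≤ i :=
      ⟨_, Finset.max'_mem _ hne, fun x hx => Finset.le_max' _ x hx⟩
    simp only [Finset.mem_sdiff, Finset.mem_range] at hi hmax
    have heq : occ.filter (fun x => ¬ x ≤ i) = Finset.Ioc i n := by
      apply Finset.Subset.antisymm (hsub i)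
      intro x hx
      rw [Finset.mem_Ioc] at hx
      rw [Finset.mem_filter]
      refine ⟨?_, by omega⟩
      by_contra hxo
      have := hmax x ⟨by omega, hxo⟩
      omega
    have e0 := Finset.card_le_card h1
    rw [Nat.card_Icc] at e0
    have e1 := hsplit i
    rw [heq, Nat.card_Ioc, h3 i hi.2 (by omega)] at e1
    exact ⟨i, by omega, by omega⟩
  · rintro ⟨i, hin, hi⟩
    have e1 := hsplit i
    have e2 := Finset.card_le_card (hsub i)
    rw [Nat.card_Ioc] at e2
    have := h2 i
    omega

theorem flaws_shift (n s t : ℕ) (b : List ℕ) (hb : b.length + 1 = n) (hs : 2 ≤ s)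
    (hl : ∀ a ∈ b, 1 ≤ a ∧ a ≤ s) (ht : 1 ≤ t) :
    t + 1 ≤ flaws n (s :: b) ↔ t ≤ flaws n (1 :: b) := by
  rw [le_flaws_iff n (s :: b) (by simpa using hb)
      (by intro a ha; rcases List.mem_cons.1 ha with rfl | h
          · omega
          · exact (hl a h).1),
    le_flaws_iff n (1 :: b) (by simpa using hb)
      (by intro a ha; rcases List.mem_cons.1 ha with rfl | h
          · omega
          · exact (hl a h).1)]
  have hfull : ∀ i, s ≤ i → b.countP (· ≤ i) = b.length := by
    intro i hi
    rw [List.countP_eq_length]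
    intro a ha
    have := (hl a ha).2
    simp; omega
  apply exists_congr
  intro i
  apply and_congr_right
  intro hin
  rw [List.countP_cons, List.countP_cons]
  by_cases hsi : s ≤ i
  · have := hfull i hsi
    have h1i : 1 ≤ i := by omega
    simp [hsi, h1i]; omega
  · by_cases h1i : 1 ≤ i
    · simp [hsi, h1i]; omega
    · simp [hsi, h1i]; omega

theorem prefList_eq {n s : ℕ} (f : Fin n → Fin s) :
    prefList f = List.ofFn (fun i => (f i : ℕ) + 1) := by
  have h : ∀ l : List (Fin s), List.flatMap (fun a : Fin s => [(a : ℕ)]) l =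
      List.map (fun a : Fin s => (a : ℕ)) l := by
    intro l
    induction l with
    | nil => rfl
    | cons a l ih => simp [List.flatMap_cons, ih]
  simp only [prefList, List.bind_eq_flatMap, List.pure_def, h, List.map_map, List.map_ofFn]
  rfl

theorem prefList_cons {n s : ℕ} (f : Fin (n + 1) → Fin s) :
    prefList f = ((f 0 : ℕ) + 1) :: prefList (Fin.tail f) := by
  simp [prefList_eq, List.ofFn_succ, Fin.tail]

theorem flaws_eq_shift (n s k : ℕ) (hk : 1 ≤ k) (hs : 2 ≤ s) (g : Fin n → Fin s) :
    flaws (n + 1) (s :: prefList g) = k + 1 ↔ flaws (n + 1) (1 :: prefList g) = k := by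
  have hlen : (prefList g).length + 1 = n + 1 := by simp [prefList_eq]
  have hl : ∀ a ∈ prefList g, 1 ≤ a ∧ a ≤ s := by
    intro a ha
    simp only [prefList_eq, List.mem_ofFn] at ha
    obtain ⟨x, rfl⟩ := ha
    have := (g x).2
    omega
  have e1 := flaws_shift (n + 1) s k _ hlen hs hl hk
  have e2 := flaws_shift (n + 1) s (k + 1) _ hlen hs hl (by omega)
  omega

/-- Theorem 6.3: `p^s_{n;≤s;k+1} = p^1_{n;≤s;k}` for `k ≥ 1` and `k+2 ≤ s ≤ n`. -/
theorem stmt10 (n s k : ℕ) (hk : 1 ≤ k) (hs1 : k + 2 ≤ s) (hsn : s ≤ n) :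
    pL n n s (k + 1) s = pL n n s k 1 := by
  obtain ⟨n, rfl⟩ : ∃ n', n = n' + 1 := ⟨n - 1, by omega⟩
  have key := flaws_eq_shift n s k hk (by omega)
  unfold pL
  refine Finset.card_nbij' (fun f => Fin.cons ⟨0, by omega⟩ (Fin.tail f))
    (fun f => Fin.cons ⟨s - 1, by omega⟩ (Fin.tail f)) ?_ ?_ ?_ ?_
  · intro f hf
    simp only [Finset.coe_filter, Finset.mem_univ, true_and, Set.mem_ofPred_eq, prefList_cons,
      List.head?_cons, Option.some.injEq, Fin.tail_cons, Fin.cons_zero] at hf ⊢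
    obtain ⟨h1, h2⟩ := hf
    rw [h2] at h1
    exact ⟨(key _).1 h1, by simp⟩
  · intro f hf
    simp only [Finset.coe_filter, Finset.mem_univ, true_and, Set.mem_ofPred_eq, prefList_cons,
      List.head?_cons, Option.some.injEq, Fin.tail_cons, Fin.cons_zero] at hf ⊢
    obtain ⟨h1, h2⟩ := hf
    rw [h2] at h1
    have h3 : s - 1 + 1 = s := by omega
    rw [h3]
    exact ⟨(key _).2 h1, rfl⟩
  · intro f hf
    simp only [Finset.coe_filter, Finset.mem_univ, true_and, Set.mem_ofPred_eq, prefList_cons,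
      List.head?_cons, Option.some.injEq] at hf
    have h3 : (⟨s - 1, by omega⟩ : Fin s) = f 0 := by
      apply Fin.ext; simp only; omega
    simp only [Fin.tail_cons, h3, Fin.cons_self_tail]
  · intro f hf
    simp only [Finset.coe_filter, Finset.mem_univ, true_and, Set.mem_ofPred_eq, prefList_cons,
      List.head?_cons, Option.some.injEq] at hf
    have h3 : (⟨0, by omega⟩ : Fin s) = f 0 := by
      apply Fin.ext; simp only; omega
    simp only [Fin.tail_cons, h3, Fin.cons_self_tail]
end

section
/- For every integer n ≥ 2, p^n_{n;1} − p^{n−1}_{n;1} = p_{n−2}; that is, the number of 1-flaw preference sets of length n (with n spaces) with first entry n minus the number of those with first entry n−1 equals the number of parking functions of length n−2 (with p_0 = 1). -/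
open Finset in
/-- Weighted count of words of length `n` over the alphabet `A`. -/
def wordSum : ℕ → Finset ℕ → (Multiset ℕ → ℤ) → ℤ
  | 0, _, w => w 0
  | n + 1, A, w => ∑ a ∈ A, wordSum n A (fun s => w (a ::ₘ s))

/-- Number of entries at least `j`. -/
def geCount (s : Multiset ℕ) (j : ℕ) : ℕ := s.countP (fun a => j ≤ a)

/-- At most `k` flaws, in terms of tail counts. -/
def okFlaw (k m : ℕ) (s : Multiset ℕ) : Prop :=
  ∀ j, 1 ≤ j → j ≤ m → geCount s j + j ≤ m + 1 + k

open Classical in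
/-- Indicator of `okFlaw`. -/
noncomputable def okInd (k m : ℕ) (s : Multiset ℕ) : ℤ := if okFlaw k m s then 1 else 0

theorem wordSum_congr (n : ℕ) (A : Finset ℕ) : ∀ (w w' : Multiset ℕ → ℤ),
    (∀ s : Multiset ℕ, s.card = n → (∀ a ∈ s, a ∈ A) → w s = w' s) →
    wordSum n A w = wordSum n A w' := by
  induction n with
  | zero => intro w w' h; exact h 0 (by simp) (by simp)
  | succ n ih =>
    intro w w' h
    refine Finset.sum_congr rfl fun a ha => ih _ _ fun s hs hA => h _ (by simp [hs]) ?_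
    intro b hb
    rcases Multiset.mem_cons.1 hb with rfl | hb
    · exact ha
    · exact hA b hb

theorem wordSum_zero (n : ℕ) (A : Finset ℕ) : wordSum n A (fun _ => 0) = 0 := by
  induction n with
  | zero => rfl
  | succ n ih => simp [wordSum, ih]

theorem wordSum_sub (n : ℕ) (A : Finset ℕ) : ∀ (w w' : Multiset ℕ → ℤ),
    wordSum n A (fun s => w s - w' s) = wordSum n A w - wordSum n A w' := by
  induction n with
  | zero => intro w w'; rfl
  | succ n ih => intro w w'; simp only [wordSum, ih, Finset.sum_sub_distrib]

theorem wordSum_image (n : ℕ) (A : Finset ℕ) : ∀ (w : Multiset ℕ → ℤ),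
    wordSum n (A.image Nat.succ) w = wordSum n A (fun s => w (s.map Nat.succ)) := by
  induction n with
  | zero => intro w; rfl
  | succ n ih =>
    intro w
    simp only [wordSum, ih]
    rw [Finset.sum_image (by intro x _ y _ h; exact Nat.succ_injective h)]
    simp

theorem wordSum_peel (A : Finset ℕ) (a : ℕ) (ha : a ∉ A) (n : ℕ) : ∀ (w : Multiset ℕ → ℤ),
    wordSum n (insert a A) w = ∑ x ∈ Finset.HasAntidiagonal.antidiagonal n,
      (n.choose x.1 : ℤ) * wordSum x.2 A (fun s => w (Multiset.replicate x.1 a + s)) := by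
  induction n with
  | zero => intro w; simp [wordSum]
  | succ n ih =>
    intro w
    rw [Finset.sum_antidiagonal_choose_succ_mul
      (fun r k => wordSum k A (fun s => w (Multiset.replicate r a + s)))]
    simp only [wordSum, Finset.sum_insert ha, ih]
    rw [add_comm]
    congr 1
    · rw [Finset.sum_comm]
      refine Finset.sum_congr rfl fun x hx => ?_
      rw [Finset.mul_sum]
      simp only [Multiset.add_cons]
    · refine Finset.sum_congr rfl fun x hx => ?_
      rw [Finset.HasAntidiagonal.mem_antidiagonal] at hx
      rw [Nat.choose_symm_of_eq_add (show n = x.1 + x.2 by omega)]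
      simp only [Multiset.replicate_succ, Multiset.cons_add]

theorem geCount_add (s t : Multiset ℕ) (j : ℕ) :
    geCount (s + t) j = geCount s j + geCount t j := by simp [geCount]

theorem geCount_cons (a : ℕ) (s : Multiset ℕ) (j : ℕ) :
    geCount (a ::ₘ s) j = geCount s j + if j ≤ a then 1 else 0 := by
  simp [geCount, Multiset.countP_cons]

theorem geCount_replicate (r a j : ℕ) :
    geCount (Multiset.replicate r a) j = if j ≤ a then r else 0 := by
  induction r with
  | zero => simp [geCount]
  | succ r ih => rw [Multiset.replicate_succ, geCount_cons, ih]; split_ifs <;> rfl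

theorem geCount_map_succ (s : Multiset ℕ) (j : ℕ) :
    geCount (s.map Nat.succ) (j + 1) = geCount s j := by
  induction s using Multiset.induction with
  | empty => simp [geCount]
  | cons a s ih => rw [Multiset.map_cons, geCount_cons, geCount_cons, ih]; simp

theorem geCount_all (s : Multiset ℕ) (j : ℕ) (h : ∀ a ∈ s, j ≤ a) : geCount s j = s.card :=
  Multiset.countP_eq_card.2 h

theorem geCount_none (s : Multiset ℕ) (j : ℕ) (h : ∀ a ∈ s, a < j) : geCount s j = 0 :=
  Multiset.countP_eq_zero.2 (fun a ha => by have := h a ha; omega)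

/-! Counting formula -/

theorem okFlaw_peel (m r : ℕ) (s : Multiset ℕ) (hs : ∀ a ∈ s, 1 ≤ a) :
    okFlaw 0 (m + 1) (Multiset.replicate r 1 + s.map Nat.succ) ↔
      r + s.card ≤ m + 1 ∧ okFlaw 0 m s := by
  unfold okFlaw
  constructor
  · intro h
    constructor
    · have := h 1 le_rfl (by omega)
      rw [geCount_add, geCount_replicate, geCount_all (s.map Nat.succ)] at this
      · simp at this; omega
      · simp
    · intro j h1 h2
      have := h (j + 1) (by omega) (by omega)
      rw [geCount_add, geCount_replicate, geCount_map_succ, if_neg (by omega)] at this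
      omega
  · rintro ⟨h0, h⟩ j h1 h2
    obtain ⟨j, rfl⟩ : ∃ i, j = i + 1 := ⟨j - 1, by omega⟩
    rw [geCount_add, geCount_replicate, geCount_map_succ]
    rcases Nat.eq_zero_or_pos j with rfl | hj
    · rw [geCount_all s 0 (by simp)]; simp; omega
    · have := h j hj (by omega)
      rw [if_neg (by omega)]; omega

theorem Icc_succ_eq (m : ℕ) :
    Finset.Icc 1 (m + 1) = insert 1 ((Finset.Icc 1 m).image Nat.succ) := by
  ext x
  simp only [Finset.mem_Icc, Finset.mem_insert, Finset.mem_image]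
  constructor
  · intro h
    by_cases hx : x = 1
    · exact Or.inl hx
    · exact Or.inr ⟨x - 1, by omega, by omega⟩
  · rintro (rfl | ⟨y, hy, rfl⟩) <;> omega

theorem binom_sum (x : ℤ) (n : ℕ) :
    (x + 1) * ∑ y ∈ Finset.HasAntidiagonal.antidiagonal n, (n.choose y.1 : ℤ) * ((x - y.2) * x ^ y.2) =
      x * ((x + 1 - n) * (x + 1) ^ n) := by
  induction n generalizing x with
  | zero => simp; ring
  | succ n ih =>
    have hb : ∑ y ∈ Finset.HasAntidiagonal.antidiagonal n, (n.choose y.1 : ℤ) * x ^ y.2 = (x + 1) ^ n := by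
      rw [add_comm x 1, (Commute.all (1:ℤ) x).add_pow']
      simp
    rw [Finset.sum_antidiagonal_choose_succ_mul (fun r k => (x - (k:ℕ)) * x ^ k)]
    have h2 : ∑ y ∈ Finset.HasAntidiagonal.antidiagonal n,
        (n.choose y.1 : ℤ) * ((x - ((y.2 + 1 : ℕ) : ℤ)) * x ^ (y.2 + 1)) =
        x * ∑ y ∈ Finset.HasAntidiagonal.antidiagonal n, (n.choose y.1 : ℤ) * ((x - y.2) * x ^ y.2)
        - x * (x + 1) ^ n := by
      rw [← hb, Finset.mul_sum, Finset.mul_sum, ← Finset.sum_sub_distrib]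
      refine Finset.sum_congr rfl fun y _ => ?_
      push_cast; ring
    have h3 : ∑ y ∈ Finset.HasAntidiagonal.antidiagonal n,
        (n.choose y.2 : ℤ) * ((x - (y.2 : ℤ)) * x ^ y.2) =
        ∑ y ∈ Finset.HasAntidiagonal.antidiagonal n, (n.choose y.1 : ℤ) * ((x - y.2) * x ^ y.2) := by
      refine Finset.sum_congr rfl fun y hy => ?_
      rw [Finset.HasAntidiagonal.mem_antidiagonal] at hy
      rw [Nat.choose_symm_of_eq_add (show n = y.1 + y.2 by omega)]
    rw [h2, h3]
    have := ih x
    push_cast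
    linear_combination (x + 1) * this

theorem wordSum_ok (m : ℕ) : ∀ n, n ≤ m + 1 →
    ((m : ℤ) + 1) * wordSum n (Finset.Icc 1 m) (okInd 0 m) = (m + 1 - n) * (m + 1) ^ n := by
  induction m with
  | zero =>
    intro n hn
    interval_cases n
    · have : okFlaw 0 0 0 := by intro j h1 h2; omega
      simp [wordSum, okInd, this]
    · simp [wordSum]
  | succ m ih =>
    intro n hn
    rw [Icc_succ_eq, wordSum_peel _ _ (by simp)]
    have key : ∀ x ∈ Finset.HasAntidiagonal.antidiagonal n, wordSum x.2 ((Finset.Icc 1 m).image Nat.succ)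
        (fun s => okInd 0 (m + 1) (Multiset.replicate x.1 1 + s)) =
        if n ≤ m + 1 then wordSum x.2 (Finset.Icc 1 m) (okInd 0 m) else 0 := by
      intro x hx
      rw [Finset.HasAntidiagonal.mem_antidiagonal] at hx
      rw [wordSum_image]
      split_ifs with h
      · refine wordSum_congr _ _ _ _ fun s hs hA => ?_
        have := okFlaw_peel m x.1 s (fun a ha => (Finset.mem_Icc.1 (hA a ha)).1)
        have hh : okFlaw 0 (m + 1) (Multiset.replicate x.1 1 + s.map Nat.succ) ↔ okFlaw 0 m s := by
          rw [this, hs]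
          exact ⟨fun h => h.2, fun h => ⟨by omega, h⟩⟩
        unfold okInd
        by_cases h' : okFlaw 0 m s
        · rw [if_pos h', if_pos (hh.2 h')]
        · rw [if_neg h', if_neg (fun h => h' (hh.1 h))]
      · rw [← wordSum_zero x.2 (Finset.Icc 1 m)]
        refine wordSum_congr _ _ _ _ fun s hs hA => ?_
        have := okFlaw_peel m x.1 s (fun a ha => (Finset.mem_Icc.1 (hA a ha)).1)
        unfold okInd
        rw [if_neg]
        intro h'
        have := (this.1 h').1
        omega
    rw [Finset.sum_congr rfl fun x hx => by rw [key x hx]]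
    by_cases h : n ≤ m + 1
    · simp only [if_pos h]
      have hb := binom_sum ((m : ℤ) + 1) n
      have h4 : ((m : ℤ) + 1) * ∑ x ∈ Finset.HasAntidiagonal.antidiagonal n,
          (n.choose x.1 : ℤ) * wordSum x.2 (Finset.Icc 1 m) (okInd 0 m) =
          ∑ y ∈ Finset.HasAntidiagonal.antidiagonal n,
            (n.choose y.1 : ℤ) * (((m : ℤ) + 1 - y.2) * ((m : ℤ) + 1) ^ y.2) := by
        rw [Finset.mul_sum]
        refine Finset.sum_congr rfl fun y hy => ?_
        rw [Finset.HasAntidiagonal.mem_antidiagonal] at hy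
        rw [← ih y.2 (by omega)]; ring
      rw [← h4] at hb
      have hm : ((m : ℤ) + 1) ≠ 0 := by positivity
      apply mul_left_cancel₀ hm
      push_cast
      linear_combination hb
    · have : n = m + 2 := by omega
      subst this
      simp only [if_neg h]
      push_cast; simp; left; ring

/-! Parking process -/

theorem card_filter_insert_ge (occ : Finset ℕ) (x j : ℕ) (hx : x ∉ occ) :
    ((insert x occ).filter (fun y => j ≤ y)).card =
      (occ.filter (fun y => j ≤ y)).card + if j ≤ x then 1 else 0 := by
  rw [Finset.filter_insert]
  split_ifs
  · rw [Finset.card_insert_of_notMem (by simp [hx])]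
  · rfl

theorem occupied_inv (m : ℕ) (l : List ℕ) : (∀ a ∈ l, 1 ≤ a ∧ a ≤ m) →
    ∃ d, (occupied m l).card + d = l.length ∧ occupied m l ⊆ Finset.Icc 1 m ∧
      (∀ j, geCount l j ≤ ((occupied m l).filter (fun y => j ≤ y)).card + d) ∧
      (∀ j, j ≤ m → j ∉ occupied m l →
        geCount l (j + 1) = ((occupied m l).filter (fun y => j + 1 ≤ y)).card + d) := by
  induction l using List.reverseRecOn with
  | nil => intro _; exact ⟨0, by simp [occupied, geCount]⟩
  | append_singleton l a ih =>
    intro h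
    obtain ⟨d, h1, h2, h3, h4⟩ := ih (fun b hb => h b (by simp [hb]))
    obtain ⟨ha1, ham⟩ := h a (by simp)
    have hg : ∀ j, geCount ((l ++ [a] : List ℕ) : Multiset ℕ) j =
        geCount l j + if j ≤ a then 1 else 0 := by
      intro j
      rw [← geCount_cons]
      congr 1
      rw [Multiset.cons_coe, Multiset.coe_eq_coe]
      exact List.perm_append_singleton a l
    have ho : occupied m (l ++ [a]) = parkStep m (occupied m l) a := by
      simp [occupied, List.foldl_append]
    rw [ho]
    generalize occupied m l = occ at *
    unfold parkStep
    split_ifs with hne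
    · have hmem := Finset.min'_mem _ hne
      have hmin : ∀ y ∈ Finset.Icc a m \ occ, (Finset.Icc a m \ occ).min' hne ≤ y :=
        fun y hy => Finset.min'_le (Finset.Icc a m \ occ) y hy
      obtain ⟨x, hx⟩ : ∃ x, x = (Finset.Icc a m \ occ).min' hne := ⟨_, rfl⟩
      rw [← hx] at hmem hmin ⊢
      simp only [Finset.mem_sdiff, Finset.mem_Icc] at hmem hmin
      obtain ⟨⟨hax, hxm⟩, hxo⟩ := hmem
      refine ⟨d, ?_, ?_, ?_, ?_⟩
      · rw [Finset.card_insert_of_notMem hxo]; simp; omega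
      · apply Finset.insert_subset _ h2
        rw [Finset.mem_Icc]; omega
      · intro j
        rw [hg, card_filter_insert_ge _ _ _ hxo]
        have := h3 j
        split_ifs <;> omega
      · intro j hj hjo
        rw [Finset.mem_insert, not_or] at hjo
        rw [hg, card_filter_insert_ge _ _ _ hxo, h4 j hj hjo.2]
        have : a ≤ j → x ≤ j := fun h => hmin j ⟨⟨h, hj⟩, hjo.2⟩
        split_ifs <;> omega
    · rw [Finset.not_nonempty_iff_eq_empty, Finset.sdiff_eq_empty_iff_subset] at hne
      refine ⟨d + 1, ?_, h2, ?_, ?_⟩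
      · simp; omega
      · intro j
        rw [hg]
        have := h3 j
        split_ifs <;> omega
      · intro j hj hjo
        rw [hg, h4 j hj hjo, if_pos]
        · omega
        · by_contra hc
          exact hjo (hne (Finset.mem_Icc.2 ⟨by omega, hj⟩))

theorem flaws_le_iff (m k : ℕ) (l : List ℕ) (h : ∀ a ∈ l, 1 ≤ a ∧ a ≤ m) :
    flaws m l ≤ k ↔ okFlaw k m l := by
  obtain ⟨d, h1, h2, h3, h4⟩ := occupied_inv m l h
  have hd : flaws m l = d := by unfold flaws; omega
  rw [hd]
  generalize occupied m l = occ at *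
  constructor
  · intro hk j hj1 hjm
    have := h3 j
    have hc : (occ.filter (fun y => j ≤ y)).card ≤ (Finset.Icc j m).card := by
      apply Finset.card_le_card
      intro y hy
      rw [Finset.mem_filter] at hy
      have := Finset.mem_Icc.1 (h2 hy.1)
      rw [Finset.mem_Icc]; omega
    rw [Nat.card_Icc] at hc
    omega
  · intro hok
    have hne : (Finset.range (m + 1) \ occ).Nonempty := by
      refine ⟨0, ?_⟩
      simp only [Finset.mem_sdiff, Finset.mem_range]
      refine ⟨by omega, fun h0 => ?_⟩
      have := Finset.mem_Icc.1 (h2 h0); omega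
    have hmem := Finset.max'_mem _ hne
    have hmax : ∀ y ∈ Finset.range (m + 1) \ occ, y ≤ (Finset.range (m + 1) \ occ).max' hne :=
      fun y hy => Finset.le_max' (Finset.range (m + 1) \ occ) y hy
    obtain ⟨j, hj⟩ : ∃ j, j = (Finset.range (m + 1) \ occ).max' hne := ⟨_, rfl⟩
    rw [← hj] at hmem hmax
    simp only [Finset.mem_sdiff, Finset.mem_range] at hmem hmax
    have h5 := h4 j (by omega) hmem.2
    have hc : occ.filter (fun y => j + 1 ≤ y) = Finset.Icc (j + 1) m := by
      ext y
      rw [Finset.mem_filter, Finset.mem_Icc]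
      constructor
      · rintro ⟨hy, hj⟩
        have := Finset.mem_Icc.1 (h2 hy); omega
      · rintro ⟨hj, hm⟩
        refine ⟨?_, hj⟩
        by_contra hy
        have := hmax y ⟨by omega, hy⟩
        omega
    rw [hc, Nat.card_Icc] at h5
    by_cases hjm : j < m
    · have := hok (j + 1) (by omega) (by omega)
      omega
    · rw [geCount_none _ _ (by
        intro a ha
        have := h a (by simpa using ha)
        omega)] at h5
      omega

/-! Relating the counts to `wordSum` -/

theorem sum_fin_succ {s : ℕ} (n : ℕ) (W : List ℕ → ℤ) :
    ∑ f : Fin (n + 1) → Fin s, W (prefList f) =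
      ∑ a ∈ Finset.Icc 1 s, ∑ g : Fin n → Fin s, W (a :: prefList g) := by
  rw [← (Fin.consEquiv (fun _ => Fin s)).sum_comp, Fintype.sum_prod_type]
  have : ∀ F : ℕ → ℤ, ∑ i : Fin s, F ((i : ℕ) + 1) = ∑ a ∈ Finset.Icc 1 s, F a := by
    intro F
    rw [Fin.sum_univ_eq_sum_range (fun i => F (i + 1)), Finset.range_eq_Ico,
      Finset.sum_Ico_add' F 0 s 1]
    rfl
  rw [← this]
  simp [prefList, Fin.consEquiv, List.ofFn_succ]

theorem sum_fin_eq_wordSum {s : ℕ} (n : ℕ) : ∀ (w : Multiset ℕ → ℤ),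
    ∑ f : Fin n → Fin s, w (prefList f) = wordSum n (Finset.Icc 1 s) w := by
  induction n with
  | zero => intro w; simp [prefList, wordSum]
  | succ n ih =>
    intro w
    rw [sum_fin_succ n (fun l => w l)]
    refine Finset.sum_congr rfl fun a _ => ?_
    rw [← ih]
    simp

theorem prefList_mem {n s : ℕ} (f : Fin n → Fin s) : ∀ a ∈ prefList f, 1 ≤ a ∧ a ≤ s := by
  intro a ha
  simp [prefList] at ha
  obtain ⟨i, rfl⟩ := ha
  have := (f i).2
  omega

theorem p_eq_s14 (N : ℕ) : (p N N N 0 : ℤ) = wordSum N (Finset.Icc 1 N) (okInd 0 N) := by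
  rw [← sum_fin_eq_wordSum, p, Finset.card_filter]
  push_cast
  refine Finset.sum_congr rfl fun f _ => ?_
  unfold okInd
  rw [← flaws_le_iff N 0 _ (prefList_mem f)]
  simp

theorem pL_eq_s14 (n l : ℕ) (h1 : 1 ≤ l) (hl : l ≤ n + 1) :
    (pL (n + 1) (n + 1) (n + 1) 1 l : ℤ) = wordSum n (Finset.Icc 1 (n + 1))
      (fun s => okInd 1 (n + 1) (l ::ₘ s) - okInd 0 (n + 1) (l ::ₘ s)) := by
  rw [← sum_fin_eq_wordSum, pL, Finset.card_filter]
  push_cast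
  rw [sum_fin_succ n (fun L => if flaws (n + 1) L = 1 ∧ L.head? = some l then 1 else 0),
    Finset.sum_eq_single l]
  · refine Finset.sum_congr rfl fun f _ => ?_
    have hm : ∀ a ∈ l :: prefList f, 1 ≤ a ∧ a ≤ n + 1 := by
      intro a ha
      rcases List.mem_cons.1 ha with rfl | ha
      · exact ⟨h1, hl⟩
      · exact prefList_mem f a ha
    unfold okInd
    rw [Multiset.cons_coe, ← flaws_le_iff (n + 1) 0 _ hm, ← flaws_le_iff (n + 1) 1 _ hm]
    simp only [List.head?_cons, and_true]
    split_ifs <;> first | omega | rfl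
  · intro b _ hb
    simp [hb]
  · intro h
    exact absurd (Finset.mem_Icc.2 ⟨h1, hl⟩) h

theorem geCount_word (N r q j : ℕ) (u : Multiset ℕ) :
    geCount (Multiset.replicate r (N + 2) + (Multiset.replicate q (N + 1) + u)) j =
      (if j ≤ N + 2 then r else 0) + ((if j ≤ N + 1 then q else 0) + geCount u j) := by
  rw [geCount_add, geCount_add, geCount_replicate, geCount_replicate]

theorem okFlaw_top (N k r q b : ℕ) (hb : b ≤ 1) (u : Multiset ℕ) (hu : ∀ a ∈ u, a ≤ N) :
    okFlaw k (N + 2) ((N + 1 + b) ::ₘ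
      (Multiset.replicate r (N + 2) + (Multiset.replicate q (N + 1) + u))) ↔
    (r + b ≤ 1 + k ∧ r + q ≤ 1 + k ∧
      ∀ j, 1 ≤ j → j ≤ N → geCount u j + j + r + q ≤ N + 2 + k) := by
  have e : ∀ j, j ≤ N + 1 → geCount ((N + 1 + b) ::ₘ
      (Multiset.replicate r (N + 2) + (Multiset.replicate q (N + 1) + u))) j =
      geCount u j + r + q + 1 := by
    intro j hj
    rw [geCount_cons, geCount_word, if_pos (by omega), if_pos (by omega), if_pos (by omega)]
    omega
  have e2 : geCount ((N + 1 + b) ::ₘ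
      (Multiset.replicate r (N + 2) + (Multiset.replicate q (N + 1) + u))) (N + 2) = r + b := by
    rw [geCount_cons, geCount_word, geCount_none u _ (fun a ha => by have := hu a ha; omega),
      if_pos (by omega), if_neg (by omega)]
    split_ifs <;> omega
  have e3 : geCount u (N + 1) = 0 :=
    geCount_none u _ (fun a ha => by have := hu a ha; omega)
  unfold okFlaw
  constructor
  · intro h
    refine ⟨?_, ?_, ?_⟩
    · have := h (N + 2) (by omega) le_rfl
      omega
    · have := h (N + 1) (by omega) (by omega)
      rw [e _ le_rfl] at this
      omega
    · intro j h1 h2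
      have := h j h1 (by omega)
      rw [e _ (by omega)] at this
      omega
  · rintro ⟨ha, hb', h⟩ j h1 h2
    by_cases hj : j = N + 2
    · subst hj; omega
    · rw [e _ (by omega)]
      by_cases hj : j = N + 1
      · subst hj; omega
      · have := h j h1 (by omega)
        omega

/-- The weight difference. -/
noncomputable def wDiff (N : ℕ) (s : Multiset ℕ) : ℤ :=
  (okInd 1 (N + 2) ((N + 1 + 1) ::ₘ s) - okInd 0 (N + 2) ((N + 1 + 1) ::ₘ s)) -
  (okInd 1 (N + 2) ((N + 1 + 0) ::ₘ s) - okInd 0 (N + 2) ((N + 1 + 0) ::ₘ s))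

theorem wDiff_eq (N r q : ℕ) (u : Multiset ℕ) (hu : ∀ a ∈ u, a ≤ N) :
    wDiff N (Multiset.replicate r (N + 2) + (Multiset.replicate q (N + 1) + u)) =
      if q = 0 then
        ((if r = 1 then 1 else 0) - (if r = 2 then 1 else 0)) * okInd 0 N u
      else 0 := by
  unfold wDiff okInd
  simp only [okFlaw_top N _ r q 1 le_rfl u hu, okFlaw_top N _ r q 0 (by omega) u hu]
  by_cases hq : q = 0
  · subst hq
    by_cases hr1 : r = 1
    · subst hr1
      have : (∀ j, 1 ≤ j → j ≤ N → geCount u j + j + 1 + 0 ≤ N + 2 + 0) ↔ okFlaw 0 N u :=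
        forall_congr' fun j => by constructor <;> intro h h1 h2 <;> have := h h1 h2 <;> omega
      by_cases hk : okFlaw 0 N u <;> simp only [this, hk] <;> simp
    · by_cases hr2 : r = 2
      · subst hr2
        have : (∀ j, 1 ≤ j → j ≤ N → geCount u j + j + 2 + 0 ≤ N + 2 + 1) ↔ okFlaw 0 N u :=
          forall_congr' fun j => by constructor <;> intro h h1 h2 <;> have := h h1 h2 <;> omega
        by_cases hk : okFlaw 0 N u <;> simp only [this, hk] <;> simp
      · by_cases hr0 : r = 0
        · subst hr0; simp
        · have : ¬ r ≤ 1 := by omega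
          have : ¬ r ≤ 2 := by omega
          have : ¬ r + 1 ≤ 2 := by omega
          simp [*]
  · have a0 : (r + 1 ≤ 1 + 0 ∧ r + q ≤ 1 + 0) ↔ (r + 0 ≤ 1 + 0 ∧ r + q ≤ 1 + 0) := by omega
    have a1 : (r + 1 ≤ 1 + 1 ∧ r + q ≤ 1 + 1) ↔ (r + 0 ≤ 1 + 1 ∧ r + q ≤ 1 + 1) := by omega
    simp only [← and_assoc, a0, a1]
    simp [hq]

theorem wordSum_mul (n : ℕ) (A : Finset ℕ) (c : ℤ) : ∀ (w : Multiset ℕ → ℤ),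
    wordSum n A (fun s => c * w s) = c * wordSum n A w := by
  induction n with
  | zero => intro w; rfl
  | succ n ih => intro w; simp only [wordSum, ih, Finset.mul_sum]

theorem wordSum_wDiff (N : ℕ) : wordSum (N + 1) (Finset.Icc 1 (N + 2)) (wDiff N) =
    (N + 1) * wordSum N (Finset.Icc 1 N) (okInd 0 N) -
      ((N + 1).choose 2 : ℤ) * wordSum (N - 1) (Finset.Icc 1 N) (okInd 0 N) := by
  have hI : ∀ M, Finset.Icc 1 (M + 1) = insert (M + 1) (Finset.Icc 1 M) := by
    intro M; ext x; simp only [Finset.mem_Icc, Finset.mem_insert]; omega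
  rw [hI (N + 1), wordSum_peel _ _ (by simp), hI N]
  have key : ∀ x ∈ Finset.HasAntidiagonal.antidiagonal (N + 1),
      ((N + 1).choose x.1 : ℤ) * wordSum x.2 (insert (N + 1) (Finset.Icc 1 N))
        (fun s => wDiff N (Multiset.replicate x.1 (N + 1 + 1) + s)) =
      ((N + 1).choose x.1 : ℤ) * (((if x.1 = 1 then 1 else 0) - (if x.1 = 2 then 1 else 0)) *
        wordSum x.2 (Finset.Icc 1 N) (okInd 0 N)) := by
    intro x _
    congr 1
    rw [wordSum_peel _ _ (by simp), Finset.sum_eq_single (0, x.2)]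
    · simp only [Nat.choose_zero_right, Nat.cast_one, one_mul]
      rw [← wordSum_mul]
      refine wordSum_congr _ _ _ _ fun s hs hA => ?_
      rw [wDiff_eq N x.1 0 s (fun a ha => (Finset.mem_Icc.1 (hA a ha)).2), if_pos rfl]
    · intro y hy hne
      have hy0 : y.1 ≠ 0 := by
        intro h0
        apply hne
        rw [Finset.HasAntidiagonal.mem_antidiagonal] at hy
        ext <;> simp <;> omega
      have : wordSum y.2 (Finset.Icc 1 N) (fun s => wDiff N (Multiset.replicate x.1 (N + 1 + 1) +
          (Multiset.replicate y.1 (N + 1) + s))) = 0 := by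
        rw [← wordSum_zero y.2 (Finset.Icc 1 N)]
        refine wordSum_congr _ _ _ _ fun s hs hA => ?_
        rw [wDiff_eq N x.1 y.1 s (fun a ha => (Finset.mem_Icc.1 (hA a ha)).2), if_neg hy0]
      rw [this, mul_zero]
    · intro h; simp at h
  rw [Finset.sum_congr rfl key, Finset.Nat.sum_antidiagonal_eq_sum_range_succ_mk]
  rcases N with _ | N
  · simp [Finset.sum_range_succ]
  · rw [show (N + 1 + 1).succ = N + 3 by rfl, ← Finset.sum_subset
      (show ({1, 2} : Finset ℕ) ⊆ Finset.range (N + 3) by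
        intro x hx; simp at hx; simp; omega)]
    · rw [Finset.sum_pair (by norm_num)]
      simp
      ring
    · intro x _ hx
      simp at hx
      simp [hx.1, hx.2]

/-- Lemma 6.1: `p^n_{n;1} - p^{n-1}_{n;1} = p_{n-2}` for `n ≥ 2`. -/
theorem stmt14 (n : ℕ) (hn : 2 ≤ n) :
    (pL n n n 1 n : ℤ) - pL n n n 1 (n - 1) = p (n - 2) (n - 2) (n - 2) 0 := by
  obtain ⟨N, rfl⟩ : ∃ N, n = N + 2 := ⟨n - 2, by omega⟩
  rw [show N + 2 - 1 = N + 1 by omega, show N + 2 - 2 = N by omega, p_eq_s14,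
    pL_eq_s14 (N + 1) (N + 2) (by omega) (by omega), pL_eq_s14 (N + 1) (N + 1) (by omega) (by omega),
    ← wordSum_sub]
  have h := wordSum_wDiff N
  unfold wDiff at h
  refine Eq.trans h ?_
  have hP := wordSum_ok N N (by omega)
  rcases N with _ | N
  · simp
  · have hQ := wordSum_ok (N + 1) N (by omega)
    have hch : (2 : ℤ) * ((N + 1 + 1).choose 2 : ℤ) = (N + 2) * (N + 1) := by
      have := Nat.add_one_mul_choose_eq (N + 1) 1
      simp only [Nat.choose_one_right] at this
      have h' : ((N + 1 + 1 : ℕ) : ℤ) * ((N + 1 : ℕ) : ℤ) =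
        ((N + 1 + 1).choose (1 + 1) : ℤ) * ((1 + 1 : ℕ) : ℤ) := by exact_mod_cast this
      push_cast at h'
      linear_combination -h'
    simp only [Nat.add_sub_cancel]
    generalize wordSum (N + 1) (Finset.Icc 1 (N + 1)) (okInd 0 (N + 1)) = P at *
    generalize wordSum N (Finset.Icc 1 (N + 1)) (okInd 0 (N + 1)) = Q at *
    generalize ((N + 1 + 1).choose 2 : ℤ) = C at *
    push_cast at *
    have h0 : (2 * ((N : ℤ) + 2)) ≠ 0 := by positivity
    apply mul_left_cancel₀ h0
    linear_combination 2 * ((N : ℤ) + 1) * hP - (N + 2) * Q * hch - ((N : ℤ) + 1) * (N + 2) * hQ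
end
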